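/- Let ψ be a smooth global finite-energy 1-equivariant wave map with ψ(t,0⁺) = 0 and ψ(t,∞) = kπ for all t, where k is a nonzero integer. Fix 0 < δ₀ < 2 and suppose λ : (0,∞) → (0,∞) satisfies δ₀ ≤ E₀^{2λ(t)}(ψ⃗(t)) ≤ 2δ₀ for all t > 0. Then λ(t)/t → 0 as t → ∞. -/

import Mathlib

open MeasureTheory Real Filter Set
noncomputable section
/-- The ground state harmonic map `Q(r) = 2 arctan r`. -/
def Q (r : ℝ) : ℝ := 2 * Real.arctan r

/-- Time derivative `∂ₜψ(t,r)`. -/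
def pT (ψ : ℝ → ℝ → ℝ) (t r : ℝ) : ℝ := deriv (fun s => ψ s r) t

/-- Radial derivative `∂ᵣψ(t,r)`. -/
def pR (ψ : ℝ → ℝ → ℝ) (t r : ℝ) : ℝ := deriv (fun ρ => ψ t ρ) r

/-- Energy density `((∂ₜψ)² + (∂ᵣψ)² + sin²ψ/r²) · r`. -/
def eDen (ψ : ℝ → ℝ → ℝ) (t r : ℝ) : ℝ :=
  ((pT ψ t r) ^ 2 + (pR ψ t r) ^ 2 + (Real.sin (ψ t r)) ^ 2 / r ^ 2) * r

/-- Localized energy `E_{r₁}^{r₂}(ψ⃗(t))`. -/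
def locE (ψ : ℝ → ℝ → ℝ) (t r₁ r₂ : ℝ) : ℝ := ∫ r in Set.Ioc r₁ r₂, eDen ψ t r

/-- Total energy `E(ψ⃗(t))`. -/
def totE (ψ : ℝ → ℝ → ℝ) (t : ℝ) : ℝ := ∫ r in Set.Ioi (0:ℝ), eDen ψ t r

/-- `ψ` is a smooth global 1-equivariant wave map on `[0,∞) × (0,∞)`. -/
def IsWaveMap (ψ : ℝ → ℝ → ℝ) : Prop :=
  ContDiffOn ℝ (⊤ : ℕ∞) (fun p : ℝ × ℝ => ψ p.1 p.2) (Set.Ici (0:ℝ) ×ˢ Set.Ioi (0:ℝ)) ∧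
  ∀ t r : ℝ, 0 ≤ t → 0 < r →
    deriv (fun s => pT ψ s r) t - deriv (fun ρ => pR ψ t ρ) r
      - (1 / r) * pR ψ t r + Real.sin (2 * ψ t r) / (2 * r ^ 2) = 0

/-- Finite energy: the energy density is integrable at each time `t ≥ 0`. -/
def FiniteEnergy (ψ : ℝ → ℝ → ℝ) : Prop :=
  ∀ t : ℝ, 0 ≤ t → MeasureTheory.IntegrableOn (eDen ψ t) (Set.Ioi 0) volume

/-- The energy is conserved. -/
def EnergyConserved (ψ : ℝ → ℝ → ℝ) : Prop :=
  ∀ t : ℝ, 0 ≤ t → totE ψ t = totE ψ 0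

/-- Squared `H × L²` norm density `(ψ₁² + (∂ᵣψ₀)² + ψ₀²/r²) · r`. -/
def hl2Den (f g : ℝ → ℝ) (r : ℝ) : ℝ :=
  ((g r) ^ 2 + (deriv f r) ^ 2 + (f r) ^ 2 / r ^ 2) * r

/-- Squared `H × L²` norm of the pair `(f, g)` over the set of radii `S`. -/
def hl2Sq (f g : ℝ → ℝ) (S : Set ℝ) : ℝ := ∫ r in S, hl2Den f g r

/-- Squared `H` norm of `f` over the set of radii `S`. -/
def hSq (f : ℝ → ℝ) (S : Set ℝ) : ℝ :=
  ∫ r in S, ((deriv f r) ^ 2 + (f r) ^ 2 / r ^ 2) * r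

/-- Squared (radial) `L²` norm. -/
def l2Sq (g : ℝ → ℝ) : ℝ := ∫ r in Set.Ioi (0:ℝ), (g r) ^ 2 * r

/-- Wave map energy of a pair of data `(f, g)`. -/
def pairE (f g : ℝ → ℝ) : ℝ :=
  ∫ r in Set.Ioi (0:ℝ), ((g r) ^ 2 + (deriv f r) ^ 2 + (Real.sin (f r)) ^ 2 / r ^ 2) * r

/-- `φ` is a smooth solution of the linearized equation
`φ_tt − φ_rr − (1/r) φ_r + φ/r² = 0` on `ℝ × (0,∞)`. -/
def IsLinearWave (φ : ℝ → ℝ → ℝ) : Prop :=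
  ContDiffOn ℝ (⊤ : ℕ∞) (fun p : ℝ × ℝ => φ p.1 p.2) (Set.univ ×ˢ Set.Ioi (0:ℝ)) ∧
  ∀ t r : ℝ, 0 < r →
    deriv (fun s => pT φ s r) t - deriv (fun ρ => pR φ t ρ) r
      - (1 / r) * pR φ t r + φ t r / r ^ 2 = 0

/-- A linear wave has finite energy: its `H × L²` density is integrable at each time. -/
def LinFiniteEnergy (φ : ℝ → ℝ → ℝ) : Prop :=
  ∀ t : ℝ, MeasureTheory.IntegrableOn (hl2Den (φ t) (pT φ t)) (Set.Ioi 0) volume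

/-- Degree one boundary conditions: `ψ(t,0⁺) = 0`, `ψ(t,∞) = π`. -/
def DegreeOneBC (ψ : ℝ → ℝ → ℝ) : Prop :=
  ∀ t : ℝ, 0 ≤ t →
    Filter.Tendsto (ψ t) (nhdsWithin 0 (Set.Ioi 0)) (nhds 0) ∧
    Filter.Tendsto (ψ t) Filter.atTop (nhds Real.pi)

/-- Degree zero boundary conditions: `φ(t,0⁺) = 0`, `φ(t,∞) = 0`. -/
def DegreeZeroBC (φ : ℝ → ℝ → ℝ) : Prop :=
  ∀ t : ℝ, 0 ≤ t →
    Filter.Tendsto (φ t) (nhdsWithin 0 (Set.Ioi 0)) (nhds 0) ∧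
    Filter.Tendsto (φ t) Filter.atTop (nhds 0)


theorem integral_div_two_sq_le_half {T X : ℝ} (hT : 0 < T) (hTX : T ≤ X) :
    ∫ x in T..X, T / (2 * x ^ 2) ≤ 1 / 2 := by
  have hd : ∀ x ∈ uIcc T X, HasDerivAt (fun x : ℝ => -(T / 2) * x⁻¹) (T / (2 * x ^ 2)) x := by
    intro x hx
    rw [uIcc_of_le hTX] at hx
    have hx0 : x ≠ 0 := (hT.trans_le hx.1).ne'
    refine ((hasDerivAt_inv hx0).const_mul (-(T / 2))).congr_deriv ?_
    field_simp
  rw [intervalIntegral.integral_eq_sub_of_hasDerivAt hd]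
  · have h1 : T / 2 * T⁻¹ = 1 / 2 := by field_simp
    have h2 : 0 ≤ T / 2 * X⁻¹ := by
      have := hT.trans_le hTX
      positivity
    linarith
  · refine ContinuousOn.intervalIntegrable fun x hx => ContinuousAt.continuousWithinAt ?_
    rw [uIcc_of_le hTX] at hx
    have hx0 : x ≠ 0 := (hT.trans_le hx.1).ne'
    fun_prop (disch := positivity)

/-- A function of two null coordinates that is nonincreasing in the first and nondecreasing in the
second, and whose mixed derivative is controlled by its first derivatives, is controlled on a
rectangle by its variation along the two sides `η = A` and `ξ = X`. -/
theorem goursat_bound {n α β γ : ℝ → ℝ → ℝ} {A B T X M : ℝ}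
    (hT : 0 < T) (hTX : T ≤ X) (hAB : A ≤ B) (hM : 0 < M)
    (hα : ∀ η ∈ Icc A B, ∀ ξ ∈ Icc T X, HasDerivAt (n η) (α η ξ) ξ)
    (hβ : ∀ η ∈ Icc A B, ∀ ξ ∈ Icc T X, HasDerivAt (fun s => n s ξ) (-β η ξ) η)
    (hγ : ∀ η ∈ Icc A B, ∀ ξ ∈ Icc T X, HasDerivAt (β η) (-γ η ξ) ξ)
    (hαc : ∀ η ∈ Icc A B, ContinuousOn (α η) (Icc T X))
    (hβc : ContinuousOn (Function.uncurry β) (Icc A B ×ˢ Icc T X))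
    (hα0 : ∀ η ∈ Icc A B, ∀ ξ ∈ Icc T X, 0 ≤ α η ξ)
    (hβ0 : ∀ η ∈ Icc A B, ∀ ξ ∈ Icc T X, 0 ≤ β η ξ)
    (hb : ∀ η ∈ Icc A B, ∀ ξ ∈ Icc T X,
      γ η ξ ≤ M / (2 * T) * α η ξ + T / (2 * ξ ^ 2) * β η ξ) :
    n A T - n B T ≤ 2 * (n A X - n B X) +
      (n A X - n A T + (n A X - n B X)) * (exp (M / T * (B - A)) - 1) := by
  have hTm : T ∈ Icc T X := ⟨le_rfl, hTX⟩
  have hXm : X ∈ Icc T X := ⟨hTX, le_rfl⟩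
  have hAm : A ∈ Icc A B := ⟨le_rfl, hAB⟩
  have hBm : B ∈ Icc A B := ⟨hAB, le_rfl⟩
  have anti : ∀ ξ ∈ Icc T X, AntitoneOn (fun s => n s ξ) (Icc A B) := by
    intro ξ hξ
    refine antitoneOn_of_deriv_nonpos (convex_Icc A B)
      (fun s hs => (hβ s hs ξ hξ).continuousAt.continuousWithinAt) (fun s hs => ?_) fun s hs => ?_
    · exact (hβ s (interior_subset hs) ξ hξ).differentiableAt.differentiableWithinAt
    · rw [(hβ s (interior_subset hs) ξ hξ).deriv]
      linarith [hβ0 s (interior_subset hs) ξ hξ]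
  have hwc : ContinuousOn (fun ξ : ℝ => T / (2 * ξ ^ 2)) (Icc T X) := by
    intro ξ hξ
    have : ξ ≠ 0 := (hT.trans_le hξ.1).ne'
    refine ContinuousAt.continuousWithinAt ?_
    fun_prop (disch := positivity)
  have hw0 : ∀ ξ ∈ Icc T X, 0 ≤ T / (2 * ξ ^ 2) := fun ξ _ => by positivity
  have hβξ : ∀ η ∈ Icc A B, ContinuousOn (β η) (Icc T X) := fun η hη ξ hξ =>
    (hγ η hη ξ hξ).continuousAt.continuousWithinAt
  set F : ℝ → ℝ → ℝ := fun s ξ => T / (2 * ξ ^ 2) * β s ξ with hF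
  have hFc : ContinuousOn (Function.uncurry F) (Icc A B ×ˢ Icc T X) :=
    (hwc.comp continuousOn_snd fun p hp => hp.2).mul hβc
  have hFint : IntegrableOn (Function.uncurry F) (Icc A B ×ˢ Icc T X) :=
    hFc.integrableOn_compact (isCompact_Icc.prod isCompact_Icc)
  set a : ℝ → ℝ := fun s => n s X - n s T with ha
  have hac : ContinuousOn a (Icc A B) := fun s hs =>
    ((hβ s hs X hXm).continuousAt.sub (hβ s hs T hTm).continuousAt).continuousWithinAt
  set d : ℝ → ℝ := fun s => M / (2 * T) * a s + ∫ ξ in T..X, F s ξ with hd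
  have hFi1 : IntegrableOn (fun s => ∫ ξ in T..X, F s ξ) (Icc A B) := by
    have h := hFint.mono_set (prod_mono_right Ioc_subset_Icc_self :
      Icc A B ×ˢ Ioc T X ⊆ Icc A B ×ˢ Icc T X)
    rw [IntegrableOn, Measure.volume_eq_prod, ← Measure.prod_restrict] at h
    simpa only [IntegrableOn, intervalIntegral.integral_of_le hTX, Function.uncurry_apply_pair] using h.integral_prod_left
  have hai : IntegrableOn a (Icc A B) := hac.integrableOn_compact isCompact_Icc
  have hdi : IntegrableOn d (Icc A B) := (hai.const_mul _).add hFi1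
  have inDiff_le : ∀ s ∈ Icc A B, ∀ ξ ∈ Icc T X, β s ξ - β s X ≤ d s := by
    intro s hs ξ hξ
    have hφc : ContinuousOn (fun y => M / (2 * T) * α s y + F s y) (Icc T X) :=
      ((hαc s hs).const_mul _).add (hwc.mul (hβξ s hs))
    have hsub : Icc ξ X ⊆ Icc T X := Icc_subset_Icc_left hξ.1
    have h1 := intervalIntegral.sub_le_integral_of_hasDeriv_right_of_le
      (g := fun y => -β s y) (g' := γ s) (φ := fun y => M / (2 * T) * α s y + F s y) hξ.2
      (((hβξ s hs).mono hsub).neg)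
      (fun y hy => by
        simpa using ((hγ s hs y (hsub (Ioo_subset_Icc_self hy))).fun_neg).hasDerivWithinAt)
      ((hφc.mono hsub).integrableOn_compact isCompact_Icc)
      (fun y hy => hb s hs y (hsub (Ioo_subset_Icc_self hy)))
    have h2 : ∫ y in ξ..X, (M / (2 * T) * α s y + F s y) ≤
        ∫ y in T..X, (M / (2 * T) * α s y + F s y) := by
      refine intervalIntegral.integral_mono_interval hξ.1 hξ.2 le_rfl ?_ ?_
      · refine (ae_restrict_iff' measurableSet_Ioc).2 (ae_of_all _ fun y hy => ?_)
        have hy' := Ioc_subset_Icc_self hy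
        have := hα0 s hs y hy'
        have := hβ0 s hs y hy'
        have := hw0 y hy'
        simp only [Pi.zero_apply, hF]
        positivity
      · rw [← uIcc_of_le hTX] at hφc
        exact hφc.intervalIntegrable
    have h3 : ∫ y in T..X, (M / (2 * T) * α s y + F s y) = d s := by
      have e1 : IntervalIntegrable (α s) volume T X := by
        have := hαc s hs
        rw [← uIcc_of_le hTX] at this
        exact this.intervalIntegrable
      have e2 : IntervalIntegrable (F s) volume T X := by
        have := hwc.mul (hβξ s hs)
        rw [← uIcc_of_le hTX] at this
        exact this.intervalIntegrable
      rw [intervalIntegral.integral_add (e1.const_mul _) e2, intervalIntegral.integral_const_mul,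
        intervalIntegral.integral_eq_sub_of_hasDerivAt (f := n s) (fun y hy => ?_) e1]
      rw [uIcc_of_le hTX] at hy
      exact hα s hs y hy
    linarith
  set D : ℝ → ℝ := fun η => ∫ s in A..η, d s with hD
  have outVar_le : ∀ η ∈ Icc A B, ∀ ξ ∈ Icc T X, n η X - n η ξ - (n A X - n A ξ) ≤ D η := by
    intro η hη ξ hξ
    have hsub : Icc A η ⊆ Icc A B := Icc_subset_Icc_right hη.2
    refine intervalIntegral.sub_le_integral_of_hasDeriv_right_of_le
      (g := fun s => n s X - n s ξ) (g' := fun s => β s ξ - β s X) (φ := d) hη.1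
      (fun s hs => ((hβ s (hsub hs) X hXm).continuousAt.sub
        (hβ s (hsub hs) ξ hξ).continuousAt).continuousWithinAt)
      (fun s hs => ?_) (hdi.mono_set hsub)
      (fun s hs => inDiff_le s (hsub (Ioo_subset_Icc_self hs)) ξ hξ)
    have hs' := hsub (Ioo_subset_Icc_self hs)
    refine HasDerivAt.hasDerivWithinAt (((hβ s hs' X hXm).sub (hβ s hs' ξ hξ)).congr_deriv ?_)
    ring
  set b0 := n A X - n B X with hb0
  have inVar_le : ∀ η ∈ Icc A B, ∀ ξ ∈ Icc T X, n A ξ - n η ξ ≤ b0 + D η := by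
    intro η hη ξ hξ
    have h1 := outVar_le η hη ξ hξ
    have h2 : n B X ≤ n η X := anti X hXm hη hBm hη.2
    linarith
  set U : ℝ → ℝ := fun η => ∫ s in A..η, a s with hU
  have corr_le : ∀ η ∈ Icc A B, D η ≤ M / T * U η + b0 := by
    intro η hη
    have hsub : Icc A η ⊆ Icc A B := Icc_subset_Icc_right hη.2
    have hai' : IntervalIntegrable a volume A η :=
      (intervalIntegrable_iff_integrableOn_Icc_of_le hη.1).2 (hai.mono_set hsub)
    have hFi1' : IntervalIntegrable (fun s => ∫ ξ in T..X, F s ξ) volume A η :=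
      (intervalIntegrable_iff_integrableOn_Icc_of_le hη.1).2 (hFi1.mono_set hsub)
    have e1 : D η = M / (2 * T) * U η + ∫ s in A..η, ∫ ξ in T..X, F s ξ := by
      simp only [hD, hd, hU]
      rw [intervalIntegral.integral_add (hai'.const_mul _) hFi1',
        intervalIntegral.integral_const_mul]
    have e2 : ∫ s in A..η, ∫ ξ in T..X, F s ξ = ∫ ξ in T..X, ∫ s in A..η, F s ξ := by
      refine intervalIntegral_intervalIntegral_swap (hFint.mono_set ?_)
      rw [uIoc_of_le hη.1, uIoc_of_le hTX]
      exact prod_mono (Ioc_subset_Icc_self.trans hsub) Ioc_subset_Icc_self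
    have e3 : ∫ ξ in T..X, ∫ s in A..η, F s ξ =
        ∫ ξ in T..X, T / (2 * ξ ^ 2) * (n A ξ - n η ξ) := by
      refine intervalIntegral.integral_congr fun ξ hξ => ?_
      rw [uIcc_of_le hTX] at hξ
      simp only [hF]
      rw [intervalIntegral.integral_const_mul]
      congr 1
      rw [intervalIntegral.integral_eq_sub_of_hasDerivAt (f := fun s => -n s ξ)]
      · ring
      · intro s hs
        rw [uIcc_of_le hη.1] at hs
        simpa using (hβ s (hsub hs) ξ hξ).fun_neg
      · refine ContinuousOn.intervalIntegrable ?_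
        rw [uIcc_of_le hη.1]
        exact hβc.comp (continuousOn_id.prodMk continuousOn_const) fun s hs => ⟨hsub hs, hξ⟩
    have hnc : ∀ s ∈ Icc A B, ContinuousOn (n s) (Icc T X) := fun s hs ξ hξ =>
      (hα s hs ξ hξ).continuousAt.continuousWithinAt
    have e4 : ∫ ξ in T..X, T / (2 * ξ ^ 2) * (n A ξ - n η ξ) ≤
        ∫ ξ in T..X, T / (2 * ξ ^ 2) * (b0 + D η) := by
      refine intervalIntegral.integral_mono_on hTX ?_ ?_ fun ξ hξ =>
        mul_le_mul_of_nonneg_left (inVar_le η hη ξ hξ) (hw0 ξ hξ)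
      · refine ContinuousOn.intervalIntegrable ?_
        rw [uIcc_of_le hTX]
        exact hwc.mul ((hnc A hAm).sub (hnc η hη))
      · refine ContinuousOn.intervalIntegrable ?_
        rw [uIcc_of_le hTX]
        exact hwc.mul continuousOn_const
    rw [intervalIntegral.integral_mul_const] at e4
    have h0 : 0 ≤ b0 + D η := by
      have h1 := inVar_le η hη T hTm
      have h2 : n η T ≤ n A T := anti T hTm hAm hη hη.1
      linarith
    have h5 := mul_le_mul_of_nonneg_right (integral_div_two_sq_le_half hT hTX) h0
    have h6 : M / (2 * T) * U η = (M / T * U η) / 2 := by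
      field_simp
    linarith
  have outVar_le_prim : ∀ η ∈ Icc A B, a η ≤ M / T * U η + (n A X - n A T + b0) := by
    intro η hη
    have h1 := outVar_le η hη T hTm
    have h2 := corr_le η hη
    simp only [ha]
    linarith
  have ha0 : ∀ η ∈ Icc A B, 0 ≤ a η := by
    intro η hη
    have : MonotoneOn (n η) (Icc T X) := by
      refine monotoneOn_of_deriv_nonneg (convex_Icc T X)
        (fun s hs => (hα η hη s hs).continuousAt.continuousWithinAt) (fun s hs => ?_) fun s hs => ?_
      · exact (hα η hη s (interior_subset hs)).differentiableAt.differentiableWithinAt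
      · rw [(hα η hη s (interior_subset hs)).deriv]
        exact hα0 η hη s (interior_subset hs)
    exact sub_nonneg.2 (this hTm hXm hTX)
  have hK : 0 < M / T := by positivity
  have prim_le : U B ≤ gronwallBound 0 (M / T) (n A X - n A T + b0) (B - A) := by
    have hU0 : ∀ η ∈ Icc A B, 0 ≤ U η := fun η hη =>
      intervalIntegral.integral_nonneg hη.1 fun s hs => ha0 s ⟨hs.1, hs.2.trans hη.2⟩
    have hUc : ContinuousOn U (Icc A B) := by
      have := intervalIntegral.continuousOn_primitive_interval (μ := volume)
        (f := a) (a := A) (b := B) (by rwa [uIcc_of_le hAB])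
      rwa [uIcc_of_le hAB] at this
    have hUd : ∀ x ∈ Ico A B, HasDerivWithinAt U (a x) (Ici x) x := by
      intro x hx
      have hx' := Ico_subset_Icc_self hx
      refine intervalIntegral.integral_hasDerivWithinAt_right
        ((intervalIntegrable_iff_integrableOn_Icc_of_le hx.1).2
          (hai.mono_set (Icc_subset_Icc_right hx.2.le))) (t := Ioi x) ?_ ?_
      · refine ⟨Ioo x B, Ioo_mem_nhdsGT hx.2, ?_⟩
        exact ((hac.mono (Ioo_subset_Icc_self.trans
          (Icc_subset_Icc_left hx.1))).aestronglyMeasurable measurableSet_Ioo)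
      · exact ((hβ x hx' X hXm).continuousAt.sub (hβ x hx' T hTm).continuousAt).continuousWithinAt
    have := norm_le_gronwallBound_of_norm_deriv_right_le (f := U) (f' := a) (δ := 0)
      (K := M / T) (ε := n A X - n A T + b0) hUc hUd (by simp [hU]) (fun x hx => by
        have hx' := Ico_subset_Icc_self hx
        rw [norm_of_nonneg (ha0 x hx'), norm_of_nonneg (hU0 x hx')]
        exact outVar_le_prim x hx') B hBm
    exact (le_abs_self _).trans this
  rw [gronwallBound_of_K_ne_0 hK.ne'] at prim_le
  have h7 : M / T * U B ≤ (n A X - n A T + b0) * (exp (M / T * (B - A)) - 1) := by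
    have := mul_le_mul_of_nonneg_left prim_le hK.le
    refine this.trans (le_of_eq ?_)
    field_simp
    ring
  have h8 := inVar_le B hBm T hTm
  have h9 := corr_le B hBm
  linarith

/-- A bounded function of two null coordinates that is nonincreasing in the first and nondecreasing
in the second, and whose mixed derivative is controlled by its first derivatives, has vanishing
variation in self-similar regions. -/
theorem null_variation_small {n α β γ : ℝ → ℝ → ℝ} {E C : ℝ} (hC : 0 < C)
    (hα : ∀ η ξ, 0 < η → η < ξ → HasDerivAt (n η) (α η ξ) ξ)
    (hβ : ∀ η ξ, 0 < η → η < ξ → HasDerivAt (fun s => n s ξ) (-β η ξ) η)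
    (hγ : ∀ η ξ, 0 < η → η < ξ → HasDerivAt (β η) (-γ η ξ) ξ)
    (hαc : ∀ η, 0 < η → ContinuousOn (α η) (Ioi η))
    (hβc : ContinuousOn (Function.uncurry β) {p | 0 < p.1 ∧ p.1 < p.2})
    (hα0 : ∀ η ξ, 0 < η → η < ξ → 0 ≤ α η ξ)
    (hβ0 : ∀ η ξ, 0 < η → η < ξ → 0 ≤ β η ξ)
    (hb : ∀ η ξ, 0 < η → η < ξ → γ η ξ ^ 2 * (ξ - η) ^ 2 ≤ C * (α η ξ * β η ξ))
    (hn0 : ∀ η ξ, 0 < η → η < ξ → 0 ≤ n η ξ)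
    (hnE : ∀ η ξ, 0 < η → η < ξ → n η ξ ≤ E)
    {θ ε : ℝ} (hθ0 : 0 < θ) (hθ1 : θ < 1) (hε : 0 < ε) :
    ∃ A > 0, ∃ T₀, ∀ T ≥ T₀, A ≤ θ * T ∧ (∀ ξ ≥ T, n A ξ - n A T ≤ ε) ∧
      n A T - n (θ * T) T ≤ ε := by
  set M : ℝ := C / (1 - θ) ^ 2 with hM
  have hθ' : 0 < 1 - θ := by linarith
  have hM0 : 0 < M := by positivity
  set K := exp (M * θ) with hK
  have hK0 : 0 < K := exp_pos _
  set ε' := ε / (4 + 3 * K) with hε'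
  have hε'0 : 0 < ε' := by positivity
  have hεe : 4 * ε' + 3 * ε' * K = ε := by
    rw [hε']
    field_simp
  have mono : ∀ η, 0 < η → MonotoneOn (n η) (Ioi η) := by
    intro η hη
    refine monotoneOn_of_deriv_nonneg (convex_Ioi η)
      (fun s hs => (hα η s hη hs).continuousAt.continuousWithinAt) (fun s hs => ?_) fun s hs => ?_
    · exact (hα η s hη (interior_subset hs)).differentiableAt.differentiableWithinAt
    · rw [(hα η s hη (interior_subset hs)).deriv]
      exact hα0 η s hη (interior_subset hs)
  have anti : ∀ ξ, AntitoneOn (fun s => n s ξ) (Ioo 0 ξ) := by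
    intro ξ
    refine antitoneOn_of_deriv_nonpos (convex_Ioo 0 ξ)
      (fun s hs => (hβ s ξ hs.1 hs.2).continuousAt.continuousWithinAt) (fun s hs => ?_) fun s hs => ?_
    · have hs := interior_subset hs
      exact (hβ s ξ hs.1 hs.2).differentiableAt.differentiableWithinAt
    · have hs := interior_subset hs
      rw [(hβ s ξ hs.1 hs.2).deriv]
      linarith [hβ0 s ξ hs.1 hs.2]
  set m : ℝ → ℝ := fun η => sSup (n η '' Ioi η) with hm
  have hbdd : ∀ η, 0 < η → BddAbove (n η '' Ioi η) := by
    rintro η hη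
    refine ⟨E, ?_⟩
    rintro _ ⟨ξ, hξ, rfl⟩
    exact hnE η ξ hη hξ
  have hle : ∀ η ξ, 0 < η → η < ξ → n η ξ ≤ m η := fun η ξ hη hξ =>
    le_csSup (hbdd η hη) ⟨ξ, hξ, rfl⟩
  have hlt : ∀ η, 0 < η → ∃ ξ₀ > η, ∀ ξ ≥ ξ₀, m η - ε' < n η ξ := by
    intro η hη
    obtain ⟨_, ⟨ξ₀, hξ₀, rfl⟩, h⟩ := exists_lt_of_lt_csSup (s := n η '' Ioi η)
      (b := m η - ε') (nonempty_Ioi.image _) (by simp only [hm]; linarith)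
    exact ⟨ξ₀, hξ₀, fun ξ hξ => h.trans_le (mono η hη hξ₀ (lt_of_lt_of_le hξ₀ hξ) hξ)⟩
  have hm0 : ∀ η, 0 < η → 0 ≤ m η := fun η hη =>
    (hn0 η (η + 1) hη (by linarith)).trans (hle η (η + 1) hη (by linarith))
  obtain ⟨_, ⟨A, hA, rfl⟩, hAm⟩ := exists_lt_of_csInf_lt (s := m '' Ioi 0)
    (b := sInf (m '' Ioi 0) + ε') (nonempty_Ioi.image _) (by linarith)
  replace hA : 0 < A := hA
  have hmA : ∀ η, 0 < η → m A ≤ m η + ε' := by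
    intro η hη
    have : sInf (m '' Ioi 0) ≤ m η :=
      csInf_le ⟨0, by rintro _ ⟨η, hη, rfl⟩; exact hm0 η hη⟩ ⟨η, hη, rfl⟩
    linarith
  obtain ⟨T₁, hT₁, hT₁'⟩ := hlt A hA
  refine ⟨A, hA, max T₁ (A / θ), fun T hT => ?_⟩
  have hTT₁ : T₁ ≤ T := (le_max_left _ _).trans hT
  have hAT : A < T := lt_of_lt_of_le hT₁ hTT₁
  have hT0 : 0 < T := hA.trans hAT
  have hAθ : A ≤ θ * T := by
    have := (le_max_right T₁ (A / θ)).trans hT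
    rw [div_le_iff₀ hθ0] at this
    linarith
  have hθT : θ * T < T := by nlinarith
  have hθT0 : 0 < θ * T := by positivity
  have hε'ε : ε' ≤ ε := by nlinarith [mul_pos hε'0 hK0]
  refine ⟨hAθ, fun ξ hξ => ?_, ?_⟩
  · have h1 := hle A ξ hA (hAT.trans_le hξ)
    have h2 := hT₁' T hTT₁
    linarith
  obtain ⟨X₁, hX₁, hX₁'⟩ := hlt (θ * T) hθT0
  set X := max T X₁ with hX
  have hTX : T ≤ X := le_max_left _ _
  have reg : ∀ η ∈ Icc A (θ * T), ∀ ξ ∈ Icc T X, 0 < η ∧ η < ξ := fun η hη ξ hξ =>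
    ⟨hA.trans_le hη.1, (hη.2.trans_lt hθT).trans_le hξ.1⟩
  have key := goursat_bound (n := n) (α := α) (β := β) (γ := γ) (A := A) (B := θ * T) (T := T)
    (X := X) (M := M) hT0 hTX hAθ hM0
    (fun η hη ξ hξ => hα η ξ (reg η hη ξ hξ).1 (reg η hη ξ hξ).2)
    (fun η hη ξ hξ => hβ η ξ (reg η hη ξ hξ).1 (reg η hη ξ hξ).2)
    (fun η hη ξ hξ => hγ η ξ (reg η hη ξ hξ).1 (reg η hη ξ hξ).2)
    (fun η hη => (hαc η (hA.trans_le hη.1)).mono fun ξ hξ => (reg η hη ξ hξ).2)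
    (hβc.mono fun p hp => reg p.1 hp.1 p.2 hp.2)
    (fun η hη ξ hξ => hα0 η ξ (reg η hη ξ hξ).1 (reg η hη ξ hξ).2)
    (fun η hη ξ hξ => hβ0 η ξ (reg η hη ξ hξ).1 (reg η hη ξ hξ).2)
    (fun η hη ξ hξ => by
      obtain ⟨h1, h2⟩ := reg η hη ξ hξ
      have hξ0 : 0 < ξ := h1.trans h2
      have hα1 := hα0 η ξ h1 h2
      have hβ1 := hβ0 η ξ h1 h2
      refine (le_abs_self _).trans (abs_le_of_sq_le_sq (b := M / (2 * T) * α η ξ +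
        T / (2 * ξ ^ 2) * β η ξ) ?_ (by positivity))
      have h3 : (1 - θ) * ξ ≤ ξ - η := by
        have : η ≤ θ * ξ := hη.2.trans (mul_le_mul_of_nonneg_left hξ.1 hθ0.le)
        linarith
      have h4 : ((1 - θ) * ξ) ^ 2 ≤ (ξ - η) ^ 2 := pow_le_pow_left₀ (by positivity) h3 2
      have h5 : γ η ξ ^ 2 * ((1 - θ) * ξ) ^ 2 ≤ C * (α η ξ * β η ξ) :=
        (mul_le_mul_of_nonneg_left h4 (sq_nonneg _)).trans (hb η ξ h1 h2)
      have h6 : γ η ξ ^ 2 ≤ C * (α η ξ * β η ξ) / ((1 - θ) * ξ) ^ 2 := by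
        rwa [le_div_iff₀ (by positivity)]
      have h7 : C * (α η ξ * β η ξ) / ((1 - θ) * ξ) ^ 2 =
          4 * (M / (2 * T) * α η ξ) * (T / (2 * ξ ^ 2) * β η ξ) := by
        rw [hM]
        field_simp
        norm_num
      rw [h7] at h6
      refine h6.trans ?_
      nlinarith [sq_nonneg (M / (2 * T) * α η ξ - T / (2 * ξ ^ 2) * β η ξ)])
  have h1 := hle A X hA (hAT.trans_le hTX)
  have h2 := hX₁' X (le_max_right _ _)
  have h3 := hmA (θ * T) hθT0
  have h4 := hT₁' T hTT₁
  have h5 : 0 ≤ n A X - n A T := sub_nonneg.2 (mono A hA hAT (hAT.trans_le hTX) hTX)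
  have h6 : 0 ≤ n A X - n (θ * T) X :=
    sub_nonneg.2 (anti X ⟨hA, hAT.trans_le hTX⟩ ⟨hθT0, hθT.trans_le hTX⟩ hAθ)
  have h7 : exp (M / T * (θ * T - A)) ≤ K := by
    refine exp_le_exp.2 ?_
    have : M / T * (θ * T - A) = M * θ - M / T * A := by field_simp
    rw [this]
    have : 0 < M / T * A := by positivity
    linarith
  have h8 : (n A X - n A T + (n A X - n (θ * T) X)) * (exp (M / T * (θ * T - A)) - 1) ≤
      (3 * ε') * K := by
    refine (mul_le_mul_of_nonneg_left (b := exp (M / T * (θ * T - A)) - 1) (c := K)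
      (by linarith) (by linarith)).trans ?_
    exact mul_le_mul_of_nonneg_right (by linarith) hK0.le
  linarith

/-- The radial momentum density `2 ∂ₜψ ∂ᵣψ · r`, the flux of the energy density. -/
def mDen (ψ : ℝ → ℝ → ℝ) (t r : ℝ) : ℝ := 2 * pT ψ t r * pR ψ t r * r

theorem quadrant_mem_nhds {t r : ℝ} (ht : 0 < t) (hr : 0 < r) :
    Ioi (0 : ℝ) ×ˢ Ioi (0 : ℝ) ∈ nhds (t, r) :=
  (isOpen_Ioi.prod isOpen_Ioi).mem_nhds ⟨ht, hr⟩

theorem IsWaveMap.contDiffAt {ψ : ℝ → ℝ → ℝ} (h : IsWaveMap ψ) {x : ℝ × ℝ}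
    (hx : x ∈ Ioi (0 : ℝ) ×ˢ Ioi (0 : ℝ)) :
    ContDiffAt ℝ (⊤ : ℕ∞) (fun p : ℝ × ℝ => ψ p.1 p.2) x :=
  h.1.contDiffAt (mem_of_superset (quadrant_mem_nhds hx.1 hx.2)
    (prod_mono Ioi_subset_Ici_self subset_rfl))

theorem pT_eq_fderiv {ψ : ℝ → ℝ → ℝ} (h : IsWaveMap ψ) {x : ℝ × ℝ}
    (hx : x ∈ Ioi (0 : ℝ) ×ˢ Ioi (0 : ℝ)) :
    pT ψ x.1 x.2 = fderiv ℝ (fun p : ℝ × ℝ => ψ p.1 p.2) x (1, 0) := by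
  have h1 : HasFDerivAt (fun p : ℝ × ℝ => ψ p.1 p.2) _ (x.1, x.2) :=
    ((h.contDiffAt hx).differentiableAt (by simp)).hasFDerivAt
  exact (h1.comp_hasDerivAt x.1
    ((hasDerivAt_id x.1).prodMk (hasDerivAt_const x.1 x.2))).deriv

theorem pR_eq_fderiv {ψ : ℝ → ℝ → ℝ} (h : IsWaveMap ψ) {x : ℝ × ℝ}
    (hx : x ∈ Ioi (0 : ℝ) ×ˢ Ioi (0 : ℝ)) :
    pR ψ x.1 x.2 = fderiv ℝ (fun p : ℝ × ℝ => ψ p.1 p.2) x (0, 1) := by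
  have h1 : HasFDerivAt (fun p : ℝ × ℝ => ψ p.1 p.2) _ (x.1, x.2) :=
    ((h.contDiffAt hx).differentiableAt (by simp)).hasFDerivAt
  exact (h1.comp_hasDerivAt x.2
    ((hasDerivAt_const x.2 x.1).prodMk (hasDerivAt_id x.2))).deriv

theorem contDiffAt_fderiv_apply {f : ℝ × ℝ → ℝ} {x : ℝ × ℝ} (h : ContDiffAt ℝ (⊤ : ℕ∞) f x)
    (v : ℝ × ℝ) : ContDiffAt ℝ (⊤ : ℕ∞) (fun y => fderiv ℝ f y v) x :=
  (h.fderiv_right (m := (⊤ : ℕ∞)) (by simp)).clm_apply contDiffAt_const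

theorem IsWaveMap.contDiffAt_pT {ψ : ℝ → ℝ → ℝ} (h : IsWaveMap ψ) {x : ℝ × ℝ}
    (hx : x ∈ Ioi (0 : ℝ) ×ˢ Ioi (0 : ℝ)) :
    ContDiffAt ℝ (⊤ : ℕ∞) (fun p : ℝ × ℝ => pT ψ p.1 p.2) x := by
  refine (contDiffAt_fderiv_apply (h.contDiffAt hx) (1, 0)).congr_of_eventuallyEq ?_
  filter_upwards [quadrant_mem_nhds hx.1 hx.2] with y hy using pT_eq_fderiv h hy

theorem IsWaveMap.contDiffAt_pR {ψ : ℝ → ℝ → ℝ} (h : IsWaveMap ψ) {x : ℝ × ℝ}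
    (hx : x ∈ Ioi (0 : ℝ) ×ˢ Ioi (0 : ℝ)) :
    ContDiffAt ℝ (⊤ : ℕ∞) (fun p : ℝ × ℝ => pR ψ p.1 p.2) x := by
  refine (contDiffAt_fderiv_apply (h.contDiffAt hx) (0, 1)).congr_of_eventuallyEq ?_
  filter_upwards [quadrant_mem_nhds hx.1 hx.2] with y hy using pR_eq_fderiv h hy

theorem IsWaveMap.contDiffAt_eDen {ψ : ℝ → ℝ → ℝ} (h : IsWaveMap ψ) {x : ℝ × ℝ}
    (hx : x ∈ Ioi (0 : ℝ) ×ˢ Ioi (0 : ℝ)) :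
    ContDiffAt ℝ (⊤ : ℕ∞) (fun p : ℝ × ℝ => eDen ψ p.1 p.2) x := by
  have hr : x.2 ^ 2 ≠ 0 := pow_ne_zero _ (ne_of_gt hx.2)
  exact ((((h.contDiffAt_pT hx).pow 2).add ((h.contDiffAt_pR hx).pow 2)).add
    (((h.contDiffAt hx).sin.pow 2).div (contDiffAt_snd.pow 2) hr)).mul contDiffAt_snd

theorem IsWaveMap.contDiffAt_mDen {ψ : ℝ → ℝ → ℝ} (h : IsWaveMap ψ) {x : ℝ × ℝ}
    (hx : x ∈ Ioi (0 : ℝ) ×ˢ Ioi (0 : ℝ)) :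
    ContDiffAt ℝ (⊤ : ℕ∞) (fun p : ℝ × ℝ => mDen ψ p.1 p.2) x :=
  ((contDiffAt_const.mul (h.contDiffAt_pT hx)).mul (h.contDiffAt_pR hx)).mul contDiffAt_snd

theorem hasDerivAt_comp_curve {f : ℝ × ℝ → ℝ} {τ ρ : ℝ → ℝ} {s a b : ℝ}
    (hf : DifferentiableAt ℝ f (τ s, ρ s)) (hτ : HasDerivAt τ a s) (hρ : HasDerivAt ρ b s) :
    HasDerivAt (fun y => f (τ y, ρ y))
      (a * fderiv ℝ f (τ s, ρ s) (1, 0) + b * fderiv ℝ f (τ s, ρ s) (0, 1)) s := by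
  have h := hf.hasFDerivAt.comp_hasDerivAt s (hτ.prodMk hρ)
  refine h.congr_deriv ?_
  have : ((a, b) : ℝ × ℝ) = a • (1, 0) + b • (0, 1) := by simp
  rw [this, map_add, map_smul, map_smul, smul_eq_mul, smul_eq_mul]

/-- The second-order jet of a wave map, tested along curves. -/
theorem IsWaveMap.exists_jet {ψ : ℝ → ℝ → ℝ} (h : IsWaveMap ψ) {t r : ℝ} (ht : 0 < t)
    (hr : 0 < r) : ∃ x y z : ℝ,
      x - z - (1 / r) * pR ψ t r + sin (2 * ψ t r) / (2 * r ^ 2) = 0 ∧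
      ∀ (τ ρ : ℝ → ℝ) (s a b : ℝ), τ s = t → ρ s = r → HasDerivAt τ a s → HasDerivAt ρ b s →
        HasDerivAt (fun y => ψ (τ y) (ρ y)) (a * pT ψ t r + b * pR ψ t r) s ∧
        HasDerivAt (fun y => pT ψ (τ y) (ρ y)) (a * x + b * y) s ∧
        HasDerivAt (fun y => pR ψ (τ y) (ρ y)) (a * y + b * z) s := by
  have hx : (t, r) ∈ Ioi (0 : ℝ) ×ˢ Ioi (0 : ℝ) := ⟨ht, hr⟩
  set f : ℝ × ℝ → ℝ := fun p => ψ p.1 p.2 with hf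
  set P : ℝ × ℝ → ℝ := fun p => pT ψ p.1 p.2 with hP
  set R : ℝ × ℝ → ℝ := fun p => pR ψ p.1 p.2 with hR
  have df : DifferentiableAt ℝ f (t, r) := (h.contDiffAt hx).differentiableAt (by simp)
  have dP : DifferentiableAt ℝ P (t, r) := (h.contDiffAt_pT hx).differentiableAt (by simp)
  have dR : DifferentiableAt ℝ R (t, r) := (h.contDiffAt_pR hx).differentiableAt (by simp)
  have d2 : DifferentiableAt ℝ (fderiv ℝ f) (t, r) :=
    ((h.contDiffAt hx).fderiv_right (m := (⊤ : ℕ∞)) (by simp)).differentiableAt (by simp)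
  have sym : fderiv ℝ P (t, r) (0, 1) = fderiv ℝ R (t, r) (1, 0) := by
    have e1 : P =ᶠ[nhds (t, r)] fun y => fderiv ℝ f y (1, 0) := by
      filter_upwards [quadrant_mem_nhds ht hr] with y hy using pT_eq_fderiv h hy
    have e2 : R =ᶠ[nhds (t, r)] fun y => fderiv ℝ f y (0, 1) := by
      filter_upwards [quadrant_mem_nhds ht hr] with y hy using pR_eq_fderiv h hy
    rw [e1.fderiv_eq, e2.fderiv_eq, fderiv_clm_apply d2 (by fun_prop),
      fderiv_clm_apply d2 (by fun_prop)]
    have := (h.contDiffAt hx).isSymmSndFDerivAt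
      (by rw [minSmoothness_of_isRCLikeNormedField]; exact WithTop.coe_le_coe.2 (le_top : (2 : ℕ∞) ≤ ⊤))
    simpa using this.eq (0, 1) (1, 0)
  refine ⟨fderiv ℝ P (t, r) (1, 0), fderiv ℝ P (t, r) (0, 1), fderiv ℝ R (t, r) (0, 1), ?_, ?_⟩
  · have h1 := hasDerivAt_comp_curve (f := P) (s := t) dP (hasDerivAt_id t) (hasDerivAt_const t r)
    have h2 := hasDerivAt_comp_curve (f := R) (s := r) dR (hasDerivAt_const r t) (hasDerivAt_id r)
    have h3 := h.2 t r ht.le hr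
    have e1 : deriv (fun s => pT ψ s r) t = _ := h1.deriv
    have e2 : deriv (fun ρ => pR ψ t ρ) r = _ := h2.deriv
    rw [e1, e2] at h3
    simpa using h3
  · rintro τ ρ s a b rfl rfl hτ hρ
    refine ⟨?_, hasDerivAt_comp_curve dP hτ hρ, ?_⟩
    · have := hasDerivAt_comp_curve df hτ hρ
      rwa [← pT_eq_fderiv h hx, ← pR_eq_fderiv h hx] at this
    · have := hasDerivAt_comp_curve dR hτ hρ
      rwa [← sym] at this

theorem null_form_bound (p q σ c : ℝ) (hc : c ^ 2 ≤ 1) :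
    (q ^ 2 - p ^ 2 + σ ^ 2 - 4 * σ * c * q) ^ 2 ≤
      16 * (((p + q) ^ 2 + σ ^ 2) * ((p - q) ^ 2 + σ ^ 2)) := by
  set u := p + q with hu
  set v := p - q with hv
  have e : q ^ 2 - p ^ 2 + σ ^ 2 - 4 * σ * c * q =
      -(u * v) + σ ^ 2 + -(2 * σ * c * u) + 2 * σ * c * v := by
    rw [hu, hv]
    ring
  have h4 : ∀ x y z w : ℝ, (x + y + z + w) ^ 2 ≤ 4 * (x ^ 2 + y ^ 2 + z ^ 2 + w ^ 2) := by
    intro x y z w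
    nlinarith [sq_nonneg (x - y), sq_nonneg (x - z), sq_nonneg (x - w), sq_nonneg (y - z),
      sq_nonneg (y - w), sq_nonneg (z - w)]
  rw [e]
  refine (h4 _ _ _ _).trans ?_
  have h5 : c ^ 2 * (σ * u) ^ 2 ≤ (σ * u) ^ 2 := mul_le_of_le_one_left (sq_nonneg _) hc
  have h6 : c ^ 2 * (σ * v) ^ 2 ≤ (σ * v) ^ 2 := mul_le_of_le_one_left (sq_nonneg _) hc
  nlinarith [sq_nonneg (u * v), sq_nonneg (σ ^ 2)]

/-- The energy and momentum densities satisfy `∂ₜe = ∂ᵣm`, and `∂ₜm - ∂ᵣe` is controlled by the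
null components of the energy. -/
theorem IsWaveMap.exists_conservation {ψ : ℝ → ℝ → ℝ} (h : IsWaveMap ψ) {t r : ℝ} (ht : 0 < t)
    (hr : 0 < r) : ∃ x y z : ℝ,
      (z - y) ^ 2 * r ^ 2 ≤
        16 * ((eDen ψ t r + mDen ψ t r) * (eDen ψ t r - mDen ψ t r)) ∧
      ∀ (τ ρ : ℝ → ℝ) (s a b : ℝ), τ s = t → ρ s = r → HasDerivAt τ a s → HasDerivAt ρ b s →
        HasDerivAt (fun y => eDen ψ (τ y) (ρ y)) (a * x + b * y) s ∧
        HasDerivAt (fun y => mDen ψ (τ y) (ρ y)) (a * z + b * x) s := by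
  obtain ⟨x, y, z, hw, hj⟩ := h.exists_jet ht hr
  set p := pT ψ t r
  set q := pR ψ t r
  set S := sin (ψ t r) with hS
  set c := cos (ψ t r) with hc
  have hSc : S ^ 2 + c ^ 2 = 1 := sin_sq_add_cos_sq _
  have hr0 : r ≠ 0 := hr.ne'
  rw [sin_two_mul, ← hS, ← hc] at hw
  have hx : x = z + q / r - S * c / r ^ 2 := by
    have : x = z + 1 / r * q - 2 * S * c / (2 * r ^ 2) := by linarith
    rw [this]
    field_simp
  refine ⟨2 * (p * z + q * y) * r + 2 * p * q,
    (2 * p * y + 2 * q * z + 2 * S * c * q / r ^ 2 - 2 * S ^ 2 / r ^ 3) * r +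
      (p ^ 2 + q ^ 2 + S ^ 2 / r ^ 2),
    2 * (x * q + p * y) * r, ?_, ?_⟩
  · have hL : 2 * (x * q + p * y) * r -
        ((2 * p * y + 2 * q * z + 2 * S * c * q / r ^ 2 - 2 * S ^ 2 / r ^ 3) * r +
        (p ^ 2 + q ^ 2 + S ^ 2 / r ^ 2)) =
        q ^ 2 - p ^ 2 + (S / r) ^ 2 - 4 * (S / r) * c * q := by
      rw [hx]
      field_simp
      ring
    have hp : eDen ψ t r + mDen ψ t r = r * ((p + q) ^ 2 + (S / r) ^ 2) := by
      simp only [eDen, mDen]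
      ring
    have hm : eDen ψ t r - mDen ψ t r = r * ((p - q) ^ 2 + (S / r) ^ 2) := by
      simp only [eDen, mDen]
      ring
    rw [hL, hp, hm]
    have := null_form_bound p q (S / r) c (by nlinarith [sq_nonneg S])
    nlinarith [mul_le_mul_of_nonneg_right this (sq_nonneg r)]
  · intro τ ρ s a b hτs hρs hτ hρ
    obtain ⟨h1, h2, h3⟩ := hj τ ρ s a b hτs hρs hτ hρ
    have hρ0 : ρ s ^ 2 ≠ 0 := pow_ne_zero _ (hρs ▸ hr0)
    have h4 := (((h2.fun_pow 2).fun_add (h3.fun_pow 2)).fun_add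
      ((h1.sin.fun_pow 2).fun_div (hρ.fun_pow 2) hρ0)).fun_mul hρ
    have h5 := (((h2.const_mul 2).fun_mul h3).fun_mul hρ)
    refine ⟨h4.congr_deriv ?_, h5.congr_deriv ?_⟩
    · simp only [hτs, hρs]
      simp only [← hS, ← hc]
      rw [hx]
      field_simp
      ring
    · simp only [hτs, hρs]
      ring

theorem eDen_nonneg (ψ : ℝ → ℝ → ℝ) (t : ℝ) {r : ℝ} (hr : 0 < r) : 0 ≤ eDen ψ t r := by
  unfold eDen
  positivity

theorem abs_mDen_le (ψ : ℝ → ℝ → ℝ) (t : ℝ) {r : ℝ} (hr : 0 < r) :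
    |mDen ψ t r| ≤ eDen ψ t r := by
  have h : 0 ≤ sin (ψ t r) ^ 2 / r ^ 2 := by positivity
  unfold mDen eDen
  rw [abs_mul, abs_of_pos hr]
  refine mul_le_mul_of_nonneg_right (abs_le.2 ⟨?_, ?_⟩) hr.le
  · nlinarith [sq_nonneg (pT ψ t r + pR ψ t r)]
  · nlinarith [sq_nonneg (pT ψ t r - pR ψ t r)]

theorem IsWaveMap.continuousOn_eDen {ψ : ℝ → ℝ → ℝ} (h : IsWaveMap ψ) :
    ContinuousOn (fun p : ℝ × ℝ => eDen ψ p.1 p.2) (Ioi 0 ×ˢ Ioi 0) := fun _ hx =>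
  (h.contDiffAt_eDen hx).continuousAt.continuousWithinAt

theorem IsWaveMap.continuousOn_mDen {ψ : ℝ → ℝ → ℝ} (h : IsWaveMap ψ) :
    ContinuousOn (fun p : ℝ × ℝ => mDen ψ p.1 p.2) (Ioi 0 ×ˢ Ioi 0) := fun _ hx =>
  (h.contDiffAt_mDen hx).continuousAt.continuousWithinAt

theorem IsWaveMap.continuousOn_eDen_right {ψ : ℝ → ℝ → ℝ} (h : IsWaveMap ψ) {t : ℝ} (ht : 0 < t) :
    ContinuousOn (eDen ψ t) (Ioi 0) :=
  h.continuousOn_eDen.comp (f := fun r => (t, r)) (by fun_prop) fun _ hr => ⟨ht, hr⟩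

theorem IsWaveMap.continuousOn_mDen_left {ψ : ℝ → ℝ → ℝ} (h : IsWaveMap ψ) {r : ℝ} (hr : 0 < r) :
    ContinuousOn (fun t => mDen ψ t r) (Ioi 0) :=
  h.continuousOn_mDen.comp (f := fun t => (t, r)) (by fun_prop) fun _ ht => ⟨ht, hr⟩

theorem FiniteEnergy.intervalIntegrable {ψ : ℝ → ℝ → ℝ} (h : FiniteEnergy ψ) {t a b : ℝ}
    (ht : 0 ≤ t) (ha : 0 ≤ a) (hab : a ≤ b) : IntervalIntegrable (eDen ψ t) volume a b :=
  (intervalIntegrable_iff_integrableOn_Ioc_of_le hab).2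
    ((h t ht).mono_set fun _ hx => ha.trans_lt hx.1)

theorem locE_eq_intervalIntegral (ψ : ℝ → ℝ → ℝ) (t : ℝ) {a b : ℝ} (hab : a ≤ b) :
    locE ψ t a b = ∫ r in a..b, eDen ψ t r := (intervalIntegral.integral_of_le hab).symm

theorem locE_nonneg (ψ : ℝ → ℝ → ℝ) (t : ℝ) {a b : ℝ} (ha : 0 ≤ a) : 0 ≤ locE ψ t a b :=
  setIntegral_nonneg measurableSet_Ioc fun _ hx => eDen_nonneg ψ t (ha.trans_lt hx.1)

theorem FiniteEnergy.locE_add {ψ : ℝ → ℝ → ℝ} (h : FiniteEnergy ψ) {t a b : ℝ}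
    (ht : 0 ≤ t) (ha : 0 ≤ a) (hab : a ≤ b) : locE ψ t 0 a + locE ψ t a b = locE ψ t 0 b := by
  rw [locE_eq_intervalIntegral ψ t ha, locE_eq_intervalIntegral ψ t hab,
    locE_eq_intervalIntegral ψ t (ha.trans hab)]
  exact intervalIntegral.integral_add_adjacent_intervals (h.intervalIntegrable ht le_rfl ha)
    (h.intervalIntegrable ht ha hab)

theorem FiniteEnergy.locE_mono {ψ : ℝ → ℝ → ℝ} (h : FiniteEnergy ψ) {t a b : ℝ}
    (ht : 0 ≤ t) (ha : 0 ≤ a) (hab : a ≤ b) : locE ψ t 0 a ≤ locE ψ t 0 b := by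
  have := h.locE_add ht ha hab
  have := locE_nonneg ψ t (b := b) ha
  linarith

theorem FiniteEnergy.locE_le_totE {ψ : ℝ → ℝ → ℝ} (h : FiniteEnergy ψ) {t a b : ℝ}
    (ht : 0 ≤ t) (ha : 0 ≤ a) : locE ψ t a b ≤ totE ψ t :=
  setIntegral_mono_set (h t ht)
    ((ae_restrict_iff' measurableSet_Ioi).2 (ae_of_all _ fun _ hr => eDen_nonneg ψ t hr))
    (LE.le.eventuallyLE fun _ hx => ha.trans_lt hx.1)

theorem FiniteEnergy.tendsto_locE {ψ : ℝ → ℝ → ℝ} (h : FiniteEnergy ψ) {t : ℝ} (ht : 0 ≤ t) :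
    Tendsto (fun r => locE ψ t 0 r) atTop (nhds (totE ψ t)) := by
  have h1 := intervalIntegral_tendsto_integral_Ioi 0 (h t ht) tendsto_id
  refine h1.congr' ?_
  filter_upwards [eventually_ge_atTop 0] with r hr
  exact (locE_eq_intervalIntegral ψ t hr).symm

/-- The local energy identity on a rectangle. -/
theorem IsWaveMap.energy_identity {ψ : ℝ → ℝ → ℝ} (h : IsWaveMap ψ) {t₁ t₂ a b : ℝ}
    (ht₁ : 0 < t₁) (ht : t₁ ≤ t₂) (ha : 0 < a) (hab : a ≤ b) :
    (∫ r in a..b, eDen ψ t₂ r) - ∫ r in a..b, eDen ψ t₁ r =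
      (∫ t in t₁..t₂, mDen ψ t b) - ∫ t in t₁..t₂, mDen ψ t a := by
  have ht₂ := ht₁.trans_le ht
  set f : ℝ × ℝ → ℝ := fun p => eDen ψ p.1 p.2 with hf
  set g : ℝ × ℝ → ℝ := fun p => fderiv ℝ f p (1, 0) with hg
  have hgc : ContinuousOn g (Ioi 0 ×ˢ Ioi 0) := fun x hx =>
    (contDiffAt_fderiv_apply (h.contDiffAt_eDen hx) (1, 0)).continuousAt.continuousWithinAt
  have hd1 : ∀ t r, 0 < t → 0 < r → HasDerivAt (fun s => eDen ψ s r) (g (t, r)) t := by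
    intro t r ht hr
    have := hasDerivAt_comp_curve (f := f) (s := t)
      ((h.contDiffAt_eDen (x := (t, r)) ⟨ht, hr⟩).differentiableAt (by simp))
      (hasDerivAt_id t) (hasDerivAt_const t r)
    simpa using this
  have hd2 : ∀ t r, 0 < t → 0 < r → HasDerivAt (mDen ψ t) (g (t, r)) r := by
    intro t r ht hr
    obtain ⟨x, y, z, -, hc⟩ := h.exists_conservation ht hr
    have h1 := (hc id (fun _ => r) t 1 0 rfl rfl (hasDerivAt_id t) (hasDerivAt_const t r)).1
    have h2 := (hc (fun _ => t) id r 0 1 rfl rfl (hasDerivAt_const r t) (hasDerivAt_id r)).2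
    have h3 := h1.unique (hd1 t r ht hr)
    simp only [one_mul, zero_mul, add_zero, zero_add] at h2 h3
    rwa [← h3]
  have hsub : Icc t₁ t₂ ×ˢ Icc a b ⊆ Ioi 0 ×ˢ Ioi 0 :=
    prod_mono (fun x hx => ht₁.trans_le hx.1) (fun x hx => ha.trans_le hx.1)
  have hswap : ∫ t in t₁..t₂, ∫ r in a..b, g (t, r) = ∫ r in a..b, ∫ t in t₁..t₂, g (t, r) := by
    refine intervalIntegral_intervalIntegral_swap (F := fun t r => g (t, r)) ?_
    rw [uIoc_of_le ht, uIoc_of_le hab]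
    exact ((hgc.mono hsub).integrableOn_compact (isCompact_Icc.prod isCompact_Icc)).mono_set
      (prod_mono Ioc_subset_Icc_self Ioc_subset_Icc_self)
  have e1 : ∫ r in a..b, ∫ t in t₁..t₂, g (t, r) = ∫ r in a..b, (eDen ψ t₂ r - eDen ψ t₁ r) := by
    refine intervalIntegral.integral_congr fun r hr => ?_
    rw [uIcc_of_le hab] at hr
    have hr0 := ha.trans_le hr.1
    refine intervalIntegral.integral_eq_sub_of_hasDerivAt (f := fun t => eDen ψ t r)
      (fun t ht' => ?_) (ContinuousOn.intervalIntegrable ?_)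
    · rw [uIcc_of_le ht] at ht'
      exact hd1 t r (ht₁.trans_le ht'.1) hr0
    · rw [uIcc_of_le ht]
      exact hgc.comp (f := fun t => (t, r)) (by fun_prop) fun t ht' => ⟨ht₁.trans_le ht'.1, hr0⟩
  have e2 : ∫ t in t₁..t₂, ∫ r in a..b, g (t, r) = ∫ t in t₁..t₂, (mDen ψ t b - mDen ψ t a) := by
    refine intervalIntegral.integral_congr fun t ht' => ?_
    rw [uIcc_of_le ht] at ht'
    have ht0 := ht₁.trans_le ht'.1
    refine intervalIntegral.integral_eq_sub_of_hasDerivAt (f := mDen ψ t)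
      (fun r hr => ?_) (ContinuousOn.intervalIntegrable ?_)
    · rw [uIcc_of_le hab] at hr
      exact hd2 t r ht0 (ha.trans_le hr.1)
    · rw [uIcc_of_le hab]
      exact hgc.comp (f := fun r => (t, r)) (by fun_prop) fun r hr => ⟨ht0, ha.trans_le hr.1⟩
  have ie : ∀ t, 0 < t → IntervalIntegrable (eDen ψ t) volume a b := fun t ht' => by
    refine ContinuousOn.intervalIntegrable ((h.continuousOn_eDen_right ht').mono ?_)
    rw [uIcc_of_le hab]
    exact fun x hx => ha.trans_le hx.1
  have im : ∀ r, 0 < r → IntervalIntegrable (fun t => mDen ψ t r) volume t₁ t₂ := fun r hr => by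
    refine ContinuousOn.intervalIntegrable ((h.continuousOn_mDen_left hr).mono ?_)
    rw [uIcc_of_le ht]
    exact fun x hx => ht₁.trans_le hx.1
  rw [← intervalIntegral.integral_sub (ie t₂ ht₂) (ie t₁ ht₁), ← e1, ← hswap, e2,
    intervalIntegral.integral_sub (im b (ha.trans_le hab)) (im a ha)]

/-- The energy in a ball changes only through the flux across its boundary. -/
theorem locE_sub_eq_flux {ψ : ℝ → ℝ → ℝ} (h : IsWaveMap ψ) (hfe : FiniteEnergy ψ)
    (hcons : EnergyConserved ψ) {t₁ t₂ r : ℝ} (ht₁ : 0 < t₁) (ht : t₁ ≤ t₂) (hr : 0 < r) :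
    locE ψ t₂ 0 r - locE ψ t₁ 0 r = ∫ t in t₁..t₂, mDen ψ t r := by
  have ht₂ := ht₁.trans_le ht
  set J : ℝ → ℝ := fun r => ∫ t in t₁..t₂, mDen ψ t r with hJ
  set c := J r - (locE ψ t₂ 0 r - locE ψ t₁ 0 r) with hc
  have le_case : ∀ a b, 0 < a → a ≤ b → J b - (locE ψ t₂ 0 b - locE ψ t₁ 0 b) =
      J a - (locE ψ t₂ 0 a - locE ψ t₁ 0 a) := by
    intro a b ha hab
    have h1 := h.energy_identity ht₁ ht ha hab
    rw [← locE_eq_intervalIntegral ψ t₂ hab, ← locE_eq_intervalIntegral ψ t₁ hab] at h1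
    have h2 := hfe.locE_add ht₁.le ha.le hab
    have h3 := hfe.locE_add ht₂.le ha.le hab
    simp only [hJ]
    linarith
  have hconst : ∀ b, 0 < b → J b = c + (locE ψ t₂ 0 b - locE ψ t₁ 0 b) := by
    intro b hb
    rcases le_total r b with h1 | h1
    · have := le_case r b hr h1
      linarith
    · have := le_case b r hb h1
      linarith
  have hlim : Tendsto J atTop (nhds c) := by
    have h1 := (hfe.tendsto_locE ht₂.le).sub (hfe.tendsto_locE ht₁.le)
    rw [hcons t₂ ht₂.le, hcons t₁ ht₁.le, sub_self] at h1
    have h2 := h1.const_add c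
    rw [add_zero] at h2
    refine h2.congr' ?_
    filter_upwards [eventually_gt_atTop 0] with b hb using (hconst b hb).symm
  have hbound : ∀ R > 0, |∫ b in R..(2 * R), J b| ≤ totE ψ 0 * (t₂ - t₁) := by
    intro R hR
    have hRR : R ≤ 2 * R := by linarith
    have hswap : ∫ t in t₁..t₂, ∫ b in R..(2 * R), mDen ψ t b = ∫ b in R..(2 * R), J b := by
      refine intervalIntegral_intervalIntegral_swap (F := fun t r => mDen ψ t r) ?_
      rw [uIoc_of_le ht, uIoc_of_le hRR]
      refine ((h.continuousOn_mDen.mono (prod_mono ?_ ?_)).integrableOn_compact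
        ((isCompact_Icc (a := t₁) (b := t₂)).prod (isCompact_Icc (a := R) (b := 2 * R)))).mono_set
        (prod_mono Ioc_subset_Icc_self Ioc_subset_Icc_self)
      · exact fun x hx => ht₁.trans_le hx.1
      · exact fun x hx => hR.trans_le hx.1
    rw [← hswap]
    refine (intervalIntegral.norm_integral_le_of_norm_le_const (C := totE ψ 0)
      (f := fun t => ∫ b in R..(2 * R), mDen ψ t b) (fun t ht' => ?_)).trans_eq
      (by rw [abs_of_nonneg (sub_nonneg.2 ht)])
    rw [uIoc_of_le ht] at ht'
    have ht0 : 0 < t := ht₁.trans ht'.1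
    rw [← hcons t ht0.le]
    refine le_trans ?_ (hfe.locE_le_totE (a := R) (b := 2 * R) ht0.le hR.le)
    rw [locE_eq_intervalIntegral ψ t hRR]
    exact intervalIntegral.norm_integral_le_of_norm_le (f := mDen ψ t) (g := eDen ψ t) hRR
      (ae_of_all _ fun b hb => abs_mDen_le ψ t (hR.trans hb.1))
      (hfe.intervalIntegrable ht0.le hR.le hRR)
  have hc0 : c = 0 := by
    by_contra hne
    have hpos : 0 < |c| := abs_pos.2 hne
    obtain ⟨R₀, hR₀⟩ := eventually_atTop.1
      ((Metric.tendsto_nhds.1 hlim) (|c| / 2) (by positivity))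
    set R := max (max R₀ 1) (2 * (totE ψ 0 * (t₂ - t₁) + 1) / |c|) with hR
    have hR1 : 1 ≤ R := (le_max_right _ _).trans (le_max_left _ _)
    have hR2 : R₀ ≤ R := (le_max_left _ _).trans (le_max_left _ _)
    have hR3 : 2 * (totE ψ 0 * (t₂ - t₁) + 1) ≤ R * |c| :=
      (div_le_iff₀ hpos).1 (le_max_right _ _)
    have h1 := hbound R (by linarith)
    have h2 : ‖∫ b in R..(2 * R), (J b - c)‖ ≤ |c| / 2 * |2 * R - R| := by
      refine intervalIntegral.norm_integral_le_of_norm_le_const (fun b hb => ?_)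
      rw [uIoc_of_le (by linarith)] at hb
      exact (hR₀ b (hR2.trans hb.1.le)).le
    have hJi : IntervalIntegrable J volume R (2 * R) := by
      refine IntervalIntegrable.congr (f := fun b => c + (locE ψ t₂ 0 b - locE ψ t₁ 0 b)) ?_ ?_
      · intro b hb
        rw [uIoc_of_le (by linarith)] at hb
        exact (hconst b (by linarith [hb.1])).symm
      · have hl : ∀ t, 0 ≤ t → IntervalIntegrable (fun b => locE ψ t 0 b) volume R (2 * R) := by
          intro t ht'
          refine MonotoneOn.intervalIntegrable ?_
          rw [uIcc_of_le (by linarith)]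
          exact fun x hx y hy hxy => hfe.locE_mono ht' (by linarith [hx.1]) hxy
        exact intervalIntegrable_const.add ((hl t₂ ht₂.le).sub (hl t₁ ht₁.le))
    rw [intervalIntegral.integral_sub hJi intervalIntegrable_const,
      intervalIntegral.integral_const, smul_eq_mul, norm_eq_abs,
      show 2 * R - R = R by ring, abs_of_pos (by linarith : 0 < R)] at h2
    have h3 : |R * c| = R * |c| := by rw [abs_mul, abs_of_pos (by linarith : 0 < R)]
    have h4 := abs_sub_abs_le_abs_sub (R * c) (∫ b in R..(2 * R), J b)
    rw [abs_sub_comm, h3] at h4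
    linarith
  have : J r = c + (locE ψ t₂ 0 r - locE ψ t₁ 0 r) := hconst r hr
  rw [hc0] at this
  simp only [hJ] at this
  linarith

theorem hasDerivAt_locE_right {ψ : ℝ → ℝ → ℝ} (h : IsWaveMap ψ) (hfe : FiniteEnergy ψ)
    {t r : ℝ} (ht : 0 < t) (hr : 0 < r) :
    HasDerivAt (fun ρ => locE ψ t 0 ρ) (eDen ψ t r) r := by
  have hc := h.continuousOn_eDen_right ht
  have h1 := intervalIntegral.integral_hasDerivAt_right (hfe.intervalIntegrable ht.le le_rfl hr.le)
    (hc.stronglyMeasurableAtFilter isOpen_Ioi r hr) (hc.continuousAt (Ioi_mem_nhds hr))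
  refine h1.congr_of_eventuallyEq ?_
  filter_upwards [Ioi_mem_nhds hr] with ρ hρ
  exact locE_eq_intervalIntegral ψ t (mem_Ioi.1 hρ).le

theorem hasDerivAt_locE_left {ψ : ℝ → ℝ → ℝ} (h : IsWaveMap ψ) (hfe : FiniteEnergy ψ)
    (hcons : EnergyConserved ψ) {t r : ℝ} (ht : 0 < t) (hr : 0 < r) :
    HasDerivAt (fun τ => locE ψ τ 0 r) (mDen ψ t r) t := by
  have hc := h.continuousOn_mDen_left hr
  have ht2 : 0 < t / 2 := half_pos ht
  have hi : IntervalIntegrable (fun τ => mDen ψ τ r) volume (t / 2) t := by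
    refine ContinuousOn.intervalIntegrable (hc.mono ?_)
    rw [uIcc_of_le (by linarith)]
    exact fun x hx => ht2.trans_le hx.1
  have h1 := intervalIntegral.integral_hasDerivAt_right hi
    (hc.stronglyMeasurableAtFilter isOpen_Ioi t ht) (hc.continuousAt (Ioi_mem_nhds ht))
  refine (h1.const_add (locE ψ (t / 2) 0 r)).congr_of_eventuallyEq ?_
  filter_upwards [Ioi_mem_nhds (by linarith : t / 2 < t)] with τ hτ
  rw [← locE_sub_eq_flux h hfe hcons ht2 (mem_Ioi.1 hτ).le hr]
  ring

/-- Along a curve the energy in the ball changes with the momentum and energy densities at the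
boundary. -/
theorem hasDerivAt_locE_curve {ψ : ℝ → ℝ → ℝ} (h : IsWaveMap ψ) (hfe : FiniteEnergy ψ)
    (hcons : EnergyConserved ψ) {τ ρ : ℝ → ℝ} {s a b : ℝ} (ht : 0 < τ s) (hr : 0 < ρ s)
    (hτ : HasDerivAt τ a s) (hρ : HasDerivAt ρ b s) :
    HasDerivAt (fun y => locE ψ (τ y) 0 (ρ y))
      (a * mDen ψ (τ s) (ρ s) + b * eDen ψ (τ s) (ρ s)) s := by
  have hmem := quadrant_mem_nhds ht hr
  have h1 := hasStrictFDerivAt_uncurry_coprod (𝕜 := ℝ) (u := (τ s, ρ s))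
    (f := fun t r => locE ψ t 0 r)
    (f₁ := fun t r => mDen ψ t r • (1 : ℝ →L[ℝ] ℝ)) (f₂ := fun t r => eDen ψ t r • (1 : ℝ →L[ℝ] ℝ))
    (by
      filter_upwards [hmem] with v hv
      refine (hasDerivAt_locE_left h hfe hcons hv.1 hv.2).hasFDerivAt.congr_fderiv ?_
      ext
      simp [Function.HasUncurry.uncurry])
    (by
      filter_upwards [hmem] with v hv
      refine (hasDerivAt_locE_right h hfe hv.1 hv.2).hasFDerivAt.congr_fderiv ?_
      ext
      simp [Function.HasUncurry.uncurry])
    ((h.contDiffAt_mDen (x := (τ s, ρ s)) ⟨ht, hr⟩).continuousAt.smul continuousAt_const)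
    ((h.contDiffAt_eDen (x := (τ s, ρ s)) ⟨ht, hr⟩).continuousAt.smul continuousAt_const)
  refine (h1.hasFDerivAt.comp_hasDerivAt s (hτ.prodMk hρ)).congr_deriv ?_
  simp [Function.HasUncurry.uncurry, mul_comm]

/-- The energy in a ball as a function of the null coordinates `t - r` and `t + r`. -/
def nullE (ψ : ℝ → ℝ → ℝ) (η ξ : ℝ) : ℝ := locE ψ ((ξ + η) / 2) 0 ((ξ - η) / 2)

/-- The outgoing null derivative of `nullE`. -/
def nullOut (ψ : ℝ → ℝ → ℝ) (η ξ : ℝ) : ℝ :=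
  (eDen ψ ((ξ + η) / 2) ((ξ - η) / 2) + mDen ψ ((ξ + η) / 2) ((ξ - η) / 2)) / 2

/-- The ingoing null derivative of `nullE`, up to sign. -/
def nullIn (ψ : ℝ → ℝ → ℝ) (η ξ : ℝ) : ℝ :=
  (eDen ψ ((ξ + η) / 2) ((ξ - η) / 2) - mDen ψ ((ξ + η) / 2) ((ξ - η) / 2)) / 2

theorem nullOut_nonneg (ψ : ℝ → ℝ → ℝ) {η ξ : ℝ} (h : η < ξ) : 0 ≤ nullOut ψ η ξ := by
  have h1 := neg_le_of_abs_le (abs_mDen_le ψ ((ξ + η) / 2) (r := (ξ - η) / 2) (by linarith))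
  unfold nullOut
  linarith

theorem nullIn_nonneg (ψ : ℝ → ℝ → ℝ) {η ξ : ℝ} (h : η < ξ) : 0 ≤ nullIn ψ η ξ := by
  have h1 := le_of_abs_le (abs_mDen_le ψ ((ξ + η) / 2) (r := (ξ - η) / 2) (by linarith))
  unfold nullIn
  linarith

theorem hasDerivAt_nullE_right {ψ : ℝ → ℝ → ℝ} (h : IsWaveMap ψ) (hfe : FiniteEnergy ψ)
    (hcons : EnergyConserved ψ) {η ξ : ℝ} (h1 : 0 < ξ + η) (h2 : η < ξ) :
    HasDerivAt (nullE ψ η) (nullOut ψ η ξ) ξ := by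
  have hτ := ((hasDerivAt_id' ξ).add_const η).div_const 2
  have hρ := ((hasDerivAt_id' ξ).sub_const η).div_const 2
  refine (hasDerivAt_locE_curve h hfe hcons (τ := fun s => (s + η) / 2) (ρ := fun s => (s - η) / 2)
    (half_pos h1) (half_pos (sub_pos.2 h2)) hτ hρ).congr_deriv ?_
  unfold nullOut
  ring

theorem hasDerivAt_nullE_left {ψ : ℝ → ℝ → ℝ} (h : IsWaveMap ψ) (hfe : FiniteEnergy ψ)
    (hcons : EnergyConserved ψ) {η ξ : ℝ} (h1 : 0 < ξ + η) (h2 : η < ξ) :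
    HasDerivAt (fun s => nullE ψ s ξ) (-nullIn ψ η ξ) η := by
  have hτ := ((hasDerivAt_id' η).const_add ξ).div_const 2
  have hρ := ((hasDerivAt_id' η).const_sub ξ).div_const 2
  refine (hasDerivAt_locE_curve h hfe hcons (τ := fun s => (ξ + s) / 2) (ρ := fun s => (ξ - s) / 2)
    (half_pos h1) (half_pos (sub_pos.2 h2)) hτ hρ).congr_deriv ?_
  unfold nullIn
  ring

theorem IsWaveMap.exists_nullIn_deriv {ψ : ℝ → ℝ → ℝ} (h : IsWaveMap ψ) {η ξ : ℝ}
    (h1 : 0 < ξ + η) (h2 : η < ξ) : ∃ γ : ℝ, HasDerivAt (nullIn ψ η) (-γ) ξ ∧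
      γ ^ 2 * (ξ - η) ^ 2 ≤ 16 * (nullOut ψ η ξ * nullIn ψ η ξ) := by
  obtain ⟨x, y, z, hb, hd⟩ := h.exists_conservation (half_pos h1) (half_pos (sub_pos.2 h2))
  have hτ := ((hasDerivAt_id' ξ).add_const η).div_const 2
  have hρ := ((hasDerivAt_id' ξ).sub_const η).div_const 2
  obtain ⟨d1, d2⟩ := hd (fun s => (s + η) / 2) (fun s => (s - η) / 2) ξ _ _ rfl rfl hτ hρ
  refine ⟨(z - y) / 4, ((d1.fun_sub d2).div_const 2).congr_deriv (by ring), ?_⟩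
  unfold nullOut nullIn
  nlinarith

theorem IsWaveMap.continuousOn_nullOut {ψ : ℝ → ℝ → ℝ} (h : IsWaveMap ψ) :
    ContinuousOn (Function.uncurry (nullOut ψ)) {p | 0 < p.1 ∧ p.1 < p.2} := by
  have hmaps : MapsTo (fun p : ℝ × ℝ => ((p.2 + p.1) / 2, (p.2 - p.1) / 2))
      {p | 0 < p.1 ∧ p.1 < p.2} (Ioi 0 ×ˢ Ioi 0) := fun p hp =>
    ⟨half_pos (add_pos (hp.1.trans hp.2) hp.1), half_pos (sub_pos.2 hp.2)⟩
  exact ((h.continuousOn_eDen.comp (by fun_prop) hmaps).add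
    (h.continuousOn_mDen.comp (by fun_prop) hmaps)).div_const 2

theorem IsWaveMap.continuousOn_nullIn {ψ : ℝ → ℝ → ℝ} (h : IsWaveMap ψ) :
    ContinuousOn (Function.uncurry (nullIn ψ)) {p | 0 < p.1 ∧ p.1 < p.2} := by
  have hmaps : MapsTo (fun p : ℝ × ℝ => ((p.2 + p.1) / 2, (p.2 - p.1) / 2))
      {p | 0 < p.1 ∧ p.1 < p.2} (Ioi 0 ×ˢ Ioi 0) := fun p hp =>
    ⟨half_pos (add_pos (hp.1.trans hp.2) hp.1), half_pos (sub_pos.2 hp.2)⟩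
  exact ((h.continuousOn_eDen.comp (by fun_prop) hmaps).sub
    (h.continuousOn_mDen.comp (by fun_prop) hmaps)).div_const 2

theorem nullE_variation_small {ψ : ℝ → ℝ → ℝ} (h : IsWaveMap ψ) (hfe : FiniteEnergy ψ)
    (hcons : EnergyConserved ψ) {θ ε : ℝ} (hθ : 0 < θ) (hθ1 : θ < 1) (hε : 0 < ε) :
    ∃ A > 0, ∃ T₀, ∀ T ≥ T₀, A ≤ θ * T ∧
      (∀ ξ ≥ T, nullE ψ A ξ - nullE ψ A T ≤ ε) ∧ nullE ψ A T - nullE ψ (θ * T) T ≤ ε := by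
  have hγ : ∀ η ξ : ℝ, ∃ γ : ℝ, 0 < η → η < ξ → HasDerivAt (nullIn ψ η) (-γ) ξ ∧
      γ ^ 2 * (ξ - η) ^ 2 ≤ 16 * (nullOut ψ η ξ * nullIn ψ η ξ) := by
    intro η ξ
    by_cases h1 : 0 < η ∧ η < ξ
    · obtain ⟨γ, hγ⟩ := h.exists_nullIn_deriv (η := η) (ξ := ξ) (by linarith) h1.2
      exact ⟨γ, fun _ _ => hγ⟩
    · exact ⟨0, fun h2 h3 => absurd ⟨h2, h3⟩ h1⟩
  choose γ hγ using hγ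
  refine null_variation_small (n := nullE ψ) (α := nullOut ψ) (β := nullIn ψ) (γ := γ)
    (E := totE ψ 0) (C := 16) (by norm_num)
    (fun η ξ h1 h2 => hasDerivAt_nullE_right h hfe hcons (by linarith) h2)
    (fun η ξ h1 h2 => hasDerivAt_nullE_left h hfe hcons (by linarith) h2)
    (fun η ξ h1 h2 => (hγ η ξ h1 h2).1)
    (fun η h1 => h.continuousOn_nullOut.comp (f := fun ξ => (η, ξ)) (by fun_prop)
      fun ξ hξ => ⟨h1, hξ⟩)
    h.continuousOn_nullIn (fun η ξ _ h2 => nullOut_nonneg ψ h2)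
    (fun η ξ _ h2 => nullIn_nonneg ψ h2) (fun η ξ h1 h2 => (hγ η ξ h1 h2).2)
    (fun η ξ _ _ => locE_nonneg ψ _ le_rfl) (fun η ξ h1 h2 => ?_) hθ hθ1 hε
  rw [← hcons ((ξ + η) / 2) (by linarith)]
  exact hfe.locE_le_totE (by linarith) le_rfl

theorem exterior_energy_small {ψ : ℝ → ℝ → ℝ} (h : IsWaveMap ψ) (hfe : FiniteEnergy ψ)
    (hcons : EnergyConserved ψ) {ε : ℝ} (hε : 0 < ε) :
    ∃ R > 0, ∀ t ≥ 1, totE ψ 0 - locE ψ t 0 (t + R) ≤ ε := by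
  have h1 := hfe.tendsto_locE (t := 1) zero_le_one
  rw [hcons 1 zero_le_one] at h1
  have h2 := (tendsto_atTop_add_const_left atTop 1 tendsto_id : Tendsto (fun R : ℝ => 1 + R) _ _)
  obtain ⟨R, hR, hR0⟩ := (((h1.comp h2).eventually
    (lt_mem_nhds (by linarith : totE ψ 0 - ε < totE ψ 0))).and (eventually_gt_atTop 0)).exists
  refine ⟨R, hR0, fun t ht => ?_⟩
  have hmono : MonotoneOn (nullE ψ (-R)) (Ioi R) := by
    have hd : ∀ ξ ∈ Ioi R, HasDerivAt (nullE ψ (-R)) (nullOut ψ (-R) ξ) ξ := fun ξ hξ =>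
      hasDerivAt_nullE_right h hfe hcons (by linarith [mem_Ioi.1 hξ]) (by linarith [mem_Ioi.1 hξ])
    refine monotoneOn_of_deriv_nonneg (convex_Ioi R)
      (fun ξ hξ => (hd ξ hξ).continuousAt.continuousWithinAt)
      (fun ξ hξ => (hd ξ (interior_subset hξ)).differentiableAt.differentiableWithinAt)
      fun ξ hξ => ?_
    rw [(hd ξ (interior_subset hξ)).deriv]
    exact nullOut_nonneg ψ (by linarith [mem_Ioi.1 (interior_subset hξ)])
  have h3 := hmono (a := 2 + R) (b := 2 * t + R) (mem_Ioi.2 (by linarith))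
    (mem_Ioi.2 (by linarith)) (by linarith)
  have e : ∀ s : ℝ, nullE ψ (-R) (2 * s + R) = locE ψ s 0 (s + R) := fun s => by
    unfold nullE
    congr 1 <;> ring
  have h4 := e 1
  rw [mul_one] at h4
  rw [h4, e t] at h3
  simp only [Function.comp_apply] at hR
  linarith

/-- The primitive of `|sin|` vanishing at the origin. -/
def absSinPrim (x : ℝ) : ℝ := ∫ s in (0 : ℝ)..x, |sin s|

theorem hasDerivAt_absSinPrim (x : ℝ) : HasDerivAt absSinPrim |sin x| x :=
  continuous_sin.abs.integral_hasStrictDerivAt 0 x |>.hasDerivAt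

theorem monotone_absSinPrim : Monotone absSinPrim :=
  monotone_of_deriv_nonneg (fun x => (hasDerivAt_absSinPrim x).differentiableAt) fun x => by
    rw [(hasDerivAt_absSinPrim x).deriv]
    exact abs_nonneg _

theorem absSinPrim_zero : absSinPrim 0 = 0 := intervalIntegral.integral_same

theorem absSinPrim_pi : absSinPrim π = 2 := by
  have : absSinPrim π = ∫ s in (0 : ℝ)..π, sin s := by
    refine intervalIntegral.integral_congr fun s hs => ?_
    rw [uIcc_of_le pi_pos.le] at hs
    exact abs_of_nonneg (sin_nonneg_of_mem_Icc hs)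
  rw [this, integral_sin, cos_zero, cos_pi]
  norm_num

theorem absSinPrim_neg (x : ℝ) : absSinPrim (-x) = -absSinPrim x := by
  have h := intervalIntegral.integral_comp_neg (a := 0) (b := x) fun s => |sin s|
  simp only [sin_neg, abs_neg, neg_zero] at h
  rw [absSinPrim, absSinPrim, h, intervalIntegral.integral_symm]

theorem two_le_abs_absSinPrim {k : ℤ} (hk : k ≠ 0) : 2 ≤ |absSinPrim (k * π)| := by
  have key : ∀ m : ℤ, 0 < m → 2 ≤ absSinPrim (m * π) := by
    intro m hm
    rw [← absSinPrim_pi]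
    refine monotone_absSinPrim (le_mul_of_one_le_left pi_pos.le ?_)
    exact_mod_cast hm
  rcases hk.lt_or_gt with h | h
  · have h1 := key (-k) (by lia)
    rw [Int.cast_neg, neg_mul, absSinPrim_neg] at h1
    exact h1.trans (neg_le_abs _)
  · exact (key k h).trans (le_abs_self _)

theorem IsWaveMap.abs_absSinPrim_sub_le {ψ : ℝ → ℝ → ℝ} (h : IsWaveMap ψ) {t a b : ℝ}
    (ht : 0 < t) (ha : 0 < a) (hab : a ≤ b) {g : ℝ → ℝ} (hg : IntervalIntegrable g volume a b)
    (hle : ∀ r ∈ Ioc a b, |sin (ψ t r)| * |pR ψ t r| ≤ g r) :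
    |absSinPrim (ψ t b) - absSinPrim (ψ t a)| ≤ ∫ r in a..b, g r := by
  have hsub : Icc a b ⊆ Ioi 0 := fun x hx => ha.trans_le hx.1
  have hd : ∀ r, 0 < r → HasDerivAt (ψ t) (pR ψ t r) r := by
    intro r hr
    have := hasDerivAt_comp_curve (f := fun p : ℝ × ℝ => ψ p.1 p.2) (s := r)
      ((h.contDiffAt (x := (t, r)) ⟨ht, hr⟩).differentiableAt (by simp))
      (hasDerivAt_const r t) (hasDerivAt_id r)
    exact this.differentiableAt.hasDerivAt
  have hcψ : ContinuousOn (ψ t) (Icc a b) := fun r hr =>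
    (hd r (hsub hr)).continuousAt.continuousWithinAt
  have hcR : ContinuousOn (pR ψ t) (Icc a b) := fun r hr =>
    ((h.contDiffAt_pR (x := (t, r)) ⟨ht, hsub hr⟩).continuousAt.comp
      (f := fun r => (t, r)) (by fun_prop)).continuousWithinAt
  have hFTC : ∫ r in a..b, |sin (ψ t r)| * pR ψ t r =
      absSinPrim (ψ t b) - absSinPrim (ψ t a) := by
    refine intervalIntegral.integral_eq_sub_of_hasDerivAt (f := fun r => absSinPrim (ψ t r))
      (fun r hr => ?_) (ContinuousOn.intervalIntegrable ?_)
    · rw [uIcc_of_le hab] at hr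
      exact (hasDerivAt_absSinPrim (ψ t r)).comp r (hd r (hsub hr))
    · rw [uIcc_of_le hab]
      exact (continuous_sin.comp_continuousOn hcψ).abs.mul hcR
  rw [← hFTC]
  refine intervalIntegral.norm_integral_le_of_norm_le
    (f := fun r => |sin (ψ t r)| * pR ψ t r) hab (ae_of_all _ fun r hr => ?_) hg
  rw [norm_mul, norm_eq_abs, norm_eq_abs, abs_abs]
  exact hle r hr

theorem abs_absSinPrim_sub_le_locE {ψ : ℝ → ℝ → ℝ} (h : IsWaveMap ψ) (hfe : FiniteEnergy ψ)
    {t a b : ℝ} (ht : 0 < t) (ha : 0 < a) (hab : a ≤ b) :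
    |absSinPrim (ψ t b) - absSinPrim (ψ t a)| ≤ locE ψ t a b / 2 := by
  rw [locE_eq_intervalIntegral ψ t hab, ← intervalIntegral.integral_div]
  refine h.abs_absSinPrim_sub_le ht ha hab
    ((hfe.intervalIntegrable ht.le ha.le hab).div_const 2) fun r hr => ?_
  have hr0 : 0 < r := ha.trans hr.1
  have e : eDen ψ t r = pT ψ t r ^ 2 * r + |pR ψ t r| ^ 2 * r + |sin (ψ t r)| ^ 2 / r := by
    rw [sq_abs, sq_abs, eDen]
    field_simp
  have e2 : (|pR ψ t r| * r - |sin (ψ t r)|) ^ 2 / r = |pR ψ t r| ^ 2 * r +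
      |sin (ψ t r)| ^ 2 / r - 2 * (|sin (ψ t r)| * |pR ψ t r|) := by
    field_simp
    ring
  have h1 : 0 ≤ pT ψ t r ^ 2 * r := by positivity
  have h2 : 0 ≤ (|pR ψ t r| * r - |sin (ψ t r)|) ^ 2 / r := by positivity
  linarith

theorem abs_absSinPrim_sub_le_length {ψ : ℝ → ℝ → ℝ} (h : IsWaveMap ψ) (hfe : FiniteEnergy ψ)
    {t a b s : ℝ} (ht : 0 < t) (ha : 0 < a) (hab : a ≤ b) (hs : 0 < s) :
    |absSinPrim (ψ t b) - absSinPrim (ψ t a)| ≤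
      (s * totE ψ t + (b - a) / (s * a)) / 2 := by
  have hi := hfe.intervalIntegrable ht.le ha.le hab
  have h0 := h.abs_absSinPrim_sub_le ht ha hab (g := fun r => (s * eDen ψ t r + 1 / (s * a)) / 2)
    (((hi.const_mul s).add intervalIntegrable_const).div_const 2) fun r hr => by
      have hr0 : 0 < r := ha.trans hr.1
      have h1 : |sin (ψ t r)| * |pR ψ t r| ≤ |pR ψ t r| :=
        mul_le_of_le_one_left (abs_nonneg _) (abs_sin_le_one _)
      have h2 : |pR ψ t r| ^ 2 * r ≤ eDen ψ t r := by
        rw [sq_abs]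
        unfold eDen
        have : 0 ≤ sin (ψ t r) ^ 2 / r ^ 2 := by positivity
        exact mul_le_mul_of_nonneg_right (by nlinarith [sq_nonneg (pT ψ t r)]) hr0.le
      have h3 : 1 / (s * r) ≤ 1 / (s * a) :=
        one_div_le_one_div_of_le (by positivity) (mul_le_mul_of_nonneg_left hr.1.le hs.le)
      have h4 : (|pR ψ t r| * (s * r) - 1) ^ 2 / (s * r) =
          s * (|pR ψ t r| ^ 2 * r) + 1 / (s * r) - 2 * |pR ψ t r| := by
        field_simp
        ring
      have h5 : 0 ≤ (|pR ψ t r| * (s * r) - 1) ^ 2 / (s * r) := by positivity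
      have h6 := mul_le_mul_of_nonneg_left h2 hs.le
      linarith
  refine h0.trans ?_
  rw [intervalIntegral.integral_div, intervalIntegral.integral_add (hi.const_mul s)
    intervalIntegrable_const, intervalIntegral.integral_const_mul, intervalIntegral.integral_const,
    ← locE_eq_intervalIntegral ψ t hab, smul_eq_mul, mul_one_div]
  have := mul_le_mul_of_nonneg_left (hfe.locE_le_totE (b := b) ht.le ha.le) hs.le
  linarith

theorem abs_absSinPrim_le_of_tendsto_zero {ψ : ℝ → ℝ → ℝ} (h : IsWaveMap ψ)
    (hfe : FiniteEnergy ψ) {t b : ℝ} (ht : 0 < t) (hb : 0 < b)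
    (h0 : Tendsto (ψ t) (nhdsWithin 0 (Ioi 0)) (nhds 0)) :
    |absSinPrim (ψ t b)| ≤ locE ψ t 0 b / 2 := by
  have h1 := (((hasDerivAt_absSinPrim 0).continuousAt.tendsto.comp h0).const_sub
    (absSinPrim (ψ t b))).abs
  rw [absSinPrim_zero, sub_zero] at h1
  refine le_of_tendsto h1 ?_
  filter_upwards [Ioc_mem_nhdsGT hb] with a ha
  refine (abs_absSinPrim_sub_le_locE h hfe ht ha.1 ha.2).trans ?_
  have := hfe.locE_add ht.le ha.1.le ha.2
  have := locE_nonneg ψ t (b := a) le_rfl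
  linarith

theorem abs_absSinPrim_sub_le_exterior {ψ : ℝ → ℝ → ℝ} (h : IsWaveMap ψ)
    (hfe : FiniteEnergy ψ) {t a l : ℝ} (ht : 0 < t) (ha : 0 < a)
    (hl : Tendsto (ψ t) atTop (nhds l)) :
    |absSinPrim l - absSinPrim (ψ t a)| ≤ (totE ψ t - locE ψ t 0 a) / 2 := by
  have h1 := (((hasDerivAt_absSinPrim l).continuousAt.tendsto.comp hl).sub_const
    (absSinPrim (ψ t a))).abs
  refine le_of_tendsto h1 ?_
  filter_upwards [eventually_ge_atTop a] with b hb
  refine (abs_absSinPrim_sub_le_locE h hfe ht ha hb).trans ?_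
  have := hfe.locE_add ht.le ha.le hb
  have := hfe.locE_le_totE (b := b) ht.le le_rfl
  linarith

theorem eventually_lt_locE {ψ : ℝ → ℝ → ℝ} {k : ℤ} {δ c : ℝ} (h : IsWaveMap ψ)
    (hfe : FiniteEnergy ψ) (hcons : EnergyConserved ψ) (hk : k ≠ 0)
    (hbc0 : ∀ t : ℝ, 0 ≤ t → Tendsto (ψ t) (nhdsWithin 0 (Ioi 0)) (nhds 0))
    (hbcinf : ∀ t : ℝ, 0 ≤ t → Tendsto (ψ t) atTop (nhds (k * π)))
    (hδ : δ < 2) (hc : 0 < c) (hc1 : c < 1) :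
    ∀ᶠ t in atTop, 2 * δ < locE ψ t 0 (c * t) := by
  set ε := (2 - δ) / 8 with hεdef
  have hε : 0 < ε := by
    rw [hεdef]
    linarith
  set E := totE ψ 0 with hE
  have hE0 : 0 ≤ E := setIntegral_nonneg measurableSet_Ioi fun _ hr => eDen_nonneg ψ 0 hr
  set s := ε / (E + 1) with hs
  have hs0 : 0 < s := by positivity
  have hsE : s * E ≤ ε := by
    have : s * (E + 1) = ε := div_mul_cancel₀ _ (by positivity)
    linarith
  set θ := (1 - c) / (1 + c) with hθ
  have hθ0 : 0 < θ := div_pos (by linarith) (by linarith)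
  have hθ1 : θ < 1 := (div_lt_one (by linarith)).2 (by linarith)
  have hθc : θ * (1 + c) = 1 - c := div_mul_cancel₀ _ (by linarith)
  obtain ⟨A, hA, T₀, hT⟩ := nullE_variation_small h hfe hcons hθ0 hθ1 hε
  obtain ⟨R, hR, hext⟩ := exterior_energy_small h hfe hcons hε
  filter_upwards [eventually_ge_atTop 1, eventually_ge_atTop (T₀ / (1 + c)),
    eventually_ge_atTop (A + (A + R) / (s * ε))] with t ht1 htT htA
  by_contra! hle
  have ht0 : 0 < t := by linarith
  have hct : 0 < c * t := mul_pos hc ht0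
  obtain ⟨hAT, hout, hin⟩ := hT ((1 + c) * t) (by
    rw [div_le_iff₀ (by linarith)] at htT
    linarith)
  have hθT : θ * ((1 + c) * t) = (1 - c) * t := by rw [← mul_assoc, hθc]
  rw [hθT] at hAT hin
  have htA0 : 0 < t - A := by linarith
  have hcA : c * t ≤ t - A := by linarith
  have e1 : nullE ψ A (2 * t - A) = locE ψ t 0 (t - A) := by
    unfold nullE
    congr 1 <;> ring
  have e2 : nullE ψ ((1 - c) * t) ((1 + c) * t) = locE ψ t 0 (c * t) := by
    unfold nullE
    congr 1 <;> ring
  have h1 := hout (2 * t - A) (by linarith)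
  rw [e1] at h1
  rw [e2] at hin
  have hint : |absSinPrim (ψ t (c * t))| ≤ locE ψ t 0 (c * t) / 2 :=
    abs_absSinPrim_le_of_tendsto_zero h hfe ht0 hct (hbc0 t ht0.le)
  have hmid := abs_absSinPrim_sub_le_locE h hfe ht0 hct hcA
  have hadd := hfe.locE_add ht0.le hct.le hcA
  have hcone := abs_absSinPrim_sub_le_length h hfe ht0 htA0
    (by linarith : t - A ≤ t + R) hs0
  have hfar := abs_absSinPrim_sub_le_exterior h hfe ht0 (by linarith : 0 < t + R)
    (hbcinf t ht0.le)
  have hfar2 := hext t ht1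
  rw [hcons t ht0.le] at hcone hfar
  have hlen : (t + R - (t - A)) / (s * (t - A)) ≤ ε := by
    have h2 : (A + R) / (s * ε) ≤ t - A := by linarith
    rw [div_le_iff₀ (by positivity)] at h2 ⊢
    linarith
  have htri : |absSinPrim (k * π)| ≤ |absSinPrim (k * π) - absSinPrim (ψ t (t + R))| +
      |absSinPrim (ψ t (t + R)) - absSinPrim (ψ t (t - A))| +
      |absSinPrim (ψ t (t - A)) - absSinPrim (ψ t (c * t))| + |absSinPrim (ψ t (c * t))| := by
    refine le_of_eq_of_le (congrArg _ ?_) ((abs_add_le _ _).trans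
      (add_le_add_left ((abs_add_le _ _).trans (add_le_add_left (abs_add_le _ _) _)) _))
    ring
  have := two_le_abs_absSinPrim hk
  linarith

/-- the concentration scale `λ(t)` fixed by the normalization
`δ₀ ≤ E₀^{2λ(t)}(ψ⃗(t)) ≤ 2δ₀` satisfies `λ(t) = o(t)` for maps of nonzero degree. -/
theorem stmt8_scale_is_sublinear
    (ψ : ℝ → ℝ → ℝ) (k : ℤ) (δ₀ : ℝ) (lam : ℝ → ℝ)
    (hwm : IsWaveMap ψ) (hfe : FiniteEnergy ψ) (hcons : EnergyConserved ψ)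
    (hk : k ≠ 0)
    (hbc0 : ∀ t : ℝ, 0 ≤ t → Filter.Tendsto (ψ t) (nhdsWithin 0 (Set.Ioi 0)) (nhds 0))
    (hbcinf : ∀ t : ℝ, 0 ≤ t → Filter.Tendsto (ψ t) Filter.atTop (nhds (k * Real.pi)))
    (hδ0 : 0 < δ₀) (hδ2 : δ₀ < 2)
    (hlampos : ∀ t : ℝ, 0 < t → 0 < lam t)
    (hnorm : ∀ t : ℝ, 0 < t →
      δ₀ ≤ locE ψ t 0 (2 * lam t) ∧ locE ψ t 0 (2 * lam t) ≤ 2 * δ₀) :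
    Filter.Tendsto (fun t => lam t / t) Filter.atTop (nhds 0) := by
  rw [Metric.tendsto_nhds]
  intro ε hε
  have hc : 0 < min ε (1 / 2) := lt_min hε (by norm_num)
  have hc1 : min ε (1 / 2) < 1 := (min_le_right _ _).trans_lt (by norm_num)
  filter_upwards [eventually_lt_locE hwm hfe hcons hk hbc0 hbcinf hδ2 hc hc1,
    eventually_gt_atTop 0] with t ht ht0
  have hl := hlampos t ht0
  rw [dist_zero_right, norm_eq_abs, abs_of_pos (div_pos hl ht0), div_lt_iff₀ ht0]
  by_contra! hle
  have h1 : min ε (1 / 2) * t ≤ ε * t := mul_le_mul_of_nonneg_right (min_le_left _ _) ht0.le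
  have h2 := hfe.locE_mono ht0.le (mul_pos hc ht0).le
    (by linarith : min ε (1 / 2) * t ≤ 2 * lam t)
  linarith [(hnorm t ht0).2]
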